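/- For any commutative ring R, the category sMod_R of simplicial R-modules carries a model category structure in which a morphism f : X → Y is a weak equivalence if πₙX → πₙY is an isomorphism for all n ≥ 0, a fibration if NXₙ → NYₙ is surjective for all n ≥ 1, and a cofibration if it has the left lifting property with respect to all acyclic fibrations. -/

import Mathlib

open CategoryTheory CategoryTheory.Limits

universe v u

/-- A morphism `f` is a retract of a morphism `g` if there is a commutative diagram
displaying `f` as a retract of `g` in the arrow category. -/
def IsRetractOfHom {C : Type u} [Category.{v} C] {A B X Y : C}
    (f : A ⟶ B) (g : X ⟶ Y) : Prop :=
  ∃ (i : A ⟶ X) (r : X ⟶ A) (i' : B ⟶ Y) (r' : Y ⟶ B),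
    i ≫ r = 𝟙 A ∧ i' ≫ r' = 𝟙 B ∧ i ≫ g = f ≫ i' ∧ g ≫ r' = r ≫ f

/-- The axioms of a model category for three given classes of morphisms (weak equivalences,
fibrations, cofibrations) on a category `C`: `C` is closed under all small limits and
colimits, the three classes are closed under retracts, the weak equivalences satisfy
two-out-of-three, lifting of cofibrations against fibrations whenever one of the two is a
weak equivalence, and the two factorization axioms. -/
structure IsModelCategory {C : Type u} [Category.{v} C]
    (weq fib cof : MorphismProperty C) : Prop where
  hasLimits : HasLimits C
  hasColimits : HasColimits C
  weq_retract : ∀ {A B X Y : C} (f : A ⟶ B) (g : X ⟶ Y), IsRetractOfHom f g → weq g → weq f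
  fib_retract : ∀ {A B X Y : C} (f : A ⟶ B) (g : X ⟶ Y), IsRetractOfHom f g → fib g → fib f
  cof_retract : ∀ {A B X Y : C} (f : A ⟶ B) (g : X ⟶ Y), IsRetractOfHom f g → cof g → cof f
  weq_comp : ∀ {X Y Z : C} (f : X ⟶ Y) (g : Y ⟶ Z), weq f → weq g → weq (f ≫ g)
  weq_of_comp_left : ∀ {X Y Z : C} (f : X ⟶ Y) (g : Y ⟶ Z), weq f → weq (f ≫ g) → weq g
  weq_of_comp_right : ∀ {X Y Z : C} (f : X ⟶ Y) (g : Y ⟶ Z), weq g → weq (f ≫ g) → weq f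
  lift_acyclicCof_fib : ∀ {A B X Y : C} (j : A ⟶ B) (q : X ⟶ Y),
    cof j → weq j → fib q → HasLiftingProperty j q
  lift_cof_acyclicFib : ∀ {A B X Y : C} (j : A ⟶ B) (q : X ⟶ Y),
    cof j → fib q → weq q → HasLiftingProperty j q
  factor_cof_acyclicFib : ∀ {X Y : C} (f : X ⟶ Y),
    ∃ (Z : C) (i : X ⟶ Z) (p : Z ⟶ Y), cof i ∧ fib p ∧ weq p ∧ i ≫ p = f
  factor_acyclicCof_fib : ∀ {X Y : C} (f : X ⟶ Y),
    ∃ (Z : C) (i : X ⟶ Z) (p : Z ⟶ Y), cof i ∧ weq i ∧ fib p ∧ i ≫ p = f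


namespace IsModelCategory

/-- Two classes of morphisms, both stable under retracts, the first with two-out-of-three,
define a model structure as soon as every morphism factors in the two required ways, where the
left factors are allowed to be any maps with the appropriate lifting property. -/
theorem of_factorizations {C : Type u} [Category.{v} C] [HasLimits C] [HasColimits C]
    (W F : MorphismProperty C) [W.HasTwoOutOfThreeProperty] [W.IsStableUnderRetracts]
    [F.IsStableUnderRetracts]
    (h₁ : ∀ {X Y : C} (f : X ⟶ Y), ∃ (Z : C) (i : X ⟶ Z) (p : Z ⟶ Y),
      (∀ ⦃A B : C⦄ (q : A ⟶ B), W q → F q → HasLiftingProperty i q) ∧ F p ∧ W p ∧ i ≫ p = f)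
    (h₂ : ∀ {X Y : C} (f : X ⟶ Y), ∃ (Z : C) (i : X ⟶ Z) (p : Z ⟶ Y),
      (∀ ⦃A B : C⦄ (q : A ⟶ B), F q → HasLiftingProperty i q) ∧ W i ∧ F p ∧ i ≫ p = f) :
    IsModelCategory W F
      (fun _ _ f => ∀ ⦃X Y : C⦄ (q : X ⟶ Y), W q → F q → HasLiftingProperty f q) where
  hasLimits := inferInstance
  hasColimits := inferInstance
  weq_retract := by
    rintro A B X Y f g ⟨i, r, i', r', h₁, h₂, h₃, h₄⟩ hg
    exact W.of_retract (f := f) (g := g)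
      { i := Arrow.homMk i i' h₃, r := Arrow.homMk r r' h₄.symm } hg
  fib_retract := by
    rintro A B X Y f g ⟨i, r, i', r', h₁, h₂, h₃, h₄⟩ hg
    exact F.of_retract (f := f) (g := g)
      { i := Arrow.homMk i i' h₃, r := Arrow.homMk r r' h₄.symm } hg
  cof_retract := by
    rintro A B X Y f g ⟨i, r, i', r', h₁, h₂, h₃, h₄⟩ hg E G q hW hF
    have := hg q hW hF
    exact RetractArrow.leftLiftingProperty (f := g) (f' := f)
      { i := Arrow.homMk i i' h₃, r := Arrow.homMk r r' h₄.symm } q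
  weq_comp f g hf hg := W.comp_mem f g hf hg
  weq_of_comp_left f g hf hfg := W.of_precomp f g hf hfg
  weq_of_comp_right f g hg hfg := W.of_postcomp f g hg hfg
  lift_acyclicCof_fib := by
    intro A B X Y j q hj hWj hq
    obtain ⟨Z, i, p, hi, hWi, hp, rfl⟩ := h₂ j
    have := hj p (W.of_precomp i p hWi hWj) hp
    have := hi q hq
    exact (RetractArrow.ofLeftLiftingProperty (f := i ≫ p) (i := i) (p := p)
      rfl).leftLiftingProperty q
  lift_cof_acyclicFib _ q hj hF hW := hj q hW hF
  factor_cof_acyclicFib := h₁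
  factor_acyclicCof_fib f := by
    obtain ⟨Z, i, p, hi, hWi, hp, rfl⟩ := h₂ f
    exact ⟨Z, i, p, fun _ _ q _ hq => hi q hq, hWi, hp, rfl⟩

end IsModelCategory

/-- A factorization of `e.functor.map f` can be lifted along an equivalence `e`. -/
theorem CategoryTheory.Equivalence.exists_factorization {C : Type*} {D : Type*} [Category* C]
    [Category* D] (e : C ≌ D) {X Y : C} (f : X ⟶ Y) {Z : D} (i : e.functor.obj X ⟶ Z)
    (p : Z ⟶ e.functor.obj Y) (fac : i ≫ p = e.functor.map f) :
    ∃ (Z' : C) (i' : X ⟶ Z') (p' : Z' ⟶ Y), i' ≫ p' = f ∧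
      Nonempty (Arrow.mk (e.functor.map i') ≅ Arrow.mk i) ∧
      Nonempty (Arrow.mk (e.functor.map p') ≅ Arrow.mk p) ∧
      ∀ ⦃A B : C⦄ (q : A ⟶ B), HasLiftingProperty i (e.functor.map q) →
        HasLiftingProperty i' q := by
  refine ⟨e.inverse.obj Z, e.unit.app X ≫ e.inverse.map i, e.inverse.map p ≫ e.unitInv.app Y,
    ?_, ⟨Arrow.isoMk (Iso.refl _) (e.counitIso.app Z) ?_⟩,
    ⟨Arrow.isoMk (e.counitIso.app Z) (Iso.refl _) ?_⟩, ?_⟩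
  · have : e.inverse.map i ≫ e.inverse.map p = e.inverse.map (e.functor.map f) := by
      rw [← Functor.map_comp, fac]
    simp [reassoc_of% this]
  · simp
  · simp
  · intro A B q hq
    have := (e.symm.toAdjunction.hasLiftingProperty_iff i q).2 hq
    change HasLiftingProperty (e.inverse.map i) q at this
    infer_instance

/-- The criterion `IsModelCategory.of_factorizations`, transported along an equivalence. -/
theorem IsModelCategory.of_equivalence {C : Type u} [Category.{v} C] [HasLimits C]
    [HasColimits C] {D : Type*} [Category* D] (e : C ≌ D)
    (W F : MorphismProperty D) [W.HasTwoOutOfThreeProperty] [W.IsStableUnderRetracts]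
    [F.IsStableUnderRetracts]
    (h₁ : ∀ {X Y : D} (f : X ⟶ Y), ∃ (Z : D) (i : X ⟶ Z) (p : Z ⟶ Y),
      (∀ ⦃A B : D⦄ (q : A ⟶ B), W q → F q → HasLiftingProperty i q) ∧ F p ∧ W p ∧ i ≫ p = f)
    (h₂ : ∀ {X Y : D} (f : X ⟶ Y), ∃ (Z : D) (i : X ⟶ Z) (p : Z ⟶ Y),
      (∀ ⦃A B : D⦄ (q : A ⟶ B), F q → HasLiftingProperty i q) ∧ W i ∧ F p ∧ i ≫ p = f) :
    IsModelCategory (W.inverseImage e.functor) (F.inverseImage e.functor)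
      (fun _ _ f => ∀ ⦃X Y : C⦄ (q : X ⟶ Y), W.inverseImage e.functor q →
        F.inverseImage e.functor q → HasLiftingProperty f q) := by
  refine .of_factorizations _ _ (fun f => ?_) (fun f => ?_)
  · obtain ⟨Z, i, p, hi, hF, hW, fac⟩ := h₁ (e.functor.map f)
    obtain ⟨Z', i', p', fac', _, ⟨hp⟩, hi'⟩ := e.exists_factorization f i p fac
    exact ⟨Z', i', p', fun _ _ q hqW hqF => hi' q (hi _ hqW hqF),
      (F.arrow_mk_iso_iff hp).2 hF, (W.arrow_mk_iso_iff hp).2 hW, fac'⟩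
  · obtain ⟨Z, i, p, hi, hW, hF, fac⟩ := h₂ (e.functor.map f)
    obtain ⟨Z', i', p', fac', ⟨hi₀⟩, ⟨hp⟩, hi'⟩ := e.exists_factorization f i p fac
    exact ⟨Z', i', p', fun _ _ q hqF => hi' q (hi _ hqF),
      (W.arrow_mk_iso_iff hi₀).2 hW, (F.arrow_mk_iso_iff hp).2 hF, fac'⟩

lemma CategoryTheory.epi_of_exists_lift_projective {C : Type u} [Category.{v} C]
    [EnoughProjectives C] {K L : C} (q : K ⟶ L)
    (h : ∀ ⦃T : C⦄ [Projective T] (g : T ⟶ L), ∃ e, e ≫ q = g) : Epi q := by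
  obtain ⟨e, he⟩ := h (Projective.π L)
  exact epi_of_epi_fac he

namespace ChainComplex

open scoped ZeroObject

variable {A : Type u} [Category.{v} A] [Abelian A]

section Disks

variable (P : ℕ → A)

/-- The direct sum of the complexes `P n ⟶ P n` concentrated in degrees `n` and `n - 1`
(for `n = 0`, this is only `P 0` in degree `0`). -/
noncomputable abbrev disks : ChainComplex A ℕ :=
  ChainComplex.of (fun n => P (n + 1) ⊞ P n) (fun _ => biprod.snd ≫ biprod.inl) (by simp)

variable {P}

lemma disks_d (n : ℕ) : (disks P).d (n + 1) n = biprod.snd ≫ biprod.inl :=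
  ChainComplex.of_d (fun n => P (n + 1) ⊞ P n) (fun _ => biprod.snd ≫ biprod.inl) n

/-- A family of morphisms `P n ⟶ K.X n` extends to a morphism of complexes on `disks P`. -/
noncomputable def disksDesc {K : ChainComplex A ℕ} (φ : ∀ n, P n ⟶ K.X n) : disks P ⟶ K where
  f n := biprod.desc (φ (n + 1) ≫ K.d (n + 1) n) (φ n)
  comm' := by
    rintro _ n rfl
    rw [disks_d]
    ext <;> simp

@[simp]
lemma disksDesc_f {K : ChainComplex A ℕ} (φ : ∀ n, P n ⟶ K.X n) (n : ℕ) :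
    (disksDesc φ).f n = biprod.desc (φ (n + 1) ≫ K.d (n + 1) n) (φ n) := rfl

lemma disks_hom_ext {K : ChainComplex A ℕ} {φ ψ : disks P ⟶ K}
    (h : ∀ n, biprod.inr ≫ φ.f n = biprod.inr ≫ ψ.f n) : φ = ψ := by
  ext n : 1
  refine biprod.hom_ext' _ _ ?_ (h n)
  have key (χ : disks P ⟶ K) :
      biprod.inl ≫ χ.f n = biprod.inr ≫ χ.f (n + 1) ≫ K.d (n + 1) n := by
    rw [χ.comm, disks_d]
    simp
  rw [key, key, reassoc_of% (h (n + 1))]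

lemma exactAt_disks (hP : IsZero (P 0)) (n : ℕ) : (disks P).ExactAt n := by
  have split (m : ℕ) {T : A} (x : T ⟶ P (m + 1) ⊞ P m) (hx : x ≫ biprod.snd = 0) :
      (x ≫ biprod.fst ≫ biprod.inr) ≫ (disks P).d (m + 1) m = x := by
    rw [disks_d]
    ext <;> simp [hx]
  obtain _ | n := n
  · rw [HomologicalComplex.exactAt_iff_exact_up_to_refinements _ 1 0 0 (by simp) (by simp)]
    exact fun T x _ => ⟨T, 𝟙 T, inferInstance, _,
      (Category.id_comp _).trans (split 0 x (hP.eq_of_tgt _ _)).symm⟩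
  · rw [HomologicalComplex.exactAt_iff_exact_up_to_refinements _ (n + 1 + 1) _ n
      (by simp) (by simp)]
    intro T x hx
    rw [disks_d, ← Category.assoc] at hx
    exact ⟨T, 𝟙 T, inferInstance, _,
      (Category.id_comp _).trans (split (n + 1) x (zero_of_comp_mono biprod.inl hx)).symm⟩

lemma exists_lift_disks [∀ n, Projective (P n)] (hP : IsZero (P 0)) {E G : ChainComplex A ℕ}
    (q : E ⟶ G) (hq : ∀ n, 1 ≤ n → Epi (q.f n)) (g : disks P ⟶ G) :
    ∃ l : disks P ⟶ E, l ≫ q = g := by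
  have (n : ℕ) : ∃ φ : P n ⟶ E.X n, φ ≫ q.f n = biprod.inr ≫ g.f n := by
    obtain _ | n := n
    · exact ⟨0, hP.eq_of_src _ _⟩
    · have := hq (n + 1) (by simp)
      exact ⟨Projective.factorThru _ (q.f (n + 1)), Projective.factorThru_comp _ _⟩
  choose φ hφ using this
  refine ⟨disksDesc φ, disks_hom_ext fun n => ?_⟩
  simp [hφ]

end Disks

lemma quasiIso_biprod_inl (K L : ChainComplex A ℕ) (hL : ∀ n, L.ExactAt n) :
    QuasiIso (biprod.inl : K ⟶ K ⊞ L) := by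
  rw [quasiIso_iff]
  intro n
  rw [quasiIsoAt_iff_isIso_homologyMap]
  refine ⟨HomologicalComplex.homologyMap biprod.fst n, ?_, ?_⟩
  · rw [← HomologicalComplex.homologyMap_comp, biprod.inl_fst, HomologicalComplex.homologyMap_id]
  · have h := congr_arg (HomologicalComplex.homologyMap · n) (biprod.total (X := K) (Y := L))
    have h₀ : HomologicalComplex.homologyMap (biprod.snd : K ⊞ L ⟶ L) n = 0 :=
      ((L.exactAt_iff_isZero_homology n).1 (hL n)).eq_of_tgt _ _
    rwa [HomologicalComplex.homologyMap_add, HomologicalComplex.homologyMap_comp,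
      HomologicalComplex.homologyMap_comp, h₀, zero_comp, add_zero,
      HomologicalComplex.homologyMap_id] at h

/-- A factorization into a quasi-isomorphism which lifts against all morphisms that are
epimorphisms in positive degrees, followed by such a morphism. -/
theorem exists_factorization_quasiIso_epi [EnoughProjectives A] {X Y : ChainComplex A ℕ}
    (f : X ⟶ Y) :
    ∃ (Z : ChainComplex A ℕ) (i : X ⟶ Z) (p : Z ⟶ Y),
      (∀ ⦃E G : ChainComplex A ℕ⦄ (q : E ⟶ G), (∀ n, 1 ≤ n → Epi (q.f n)) →
        HasLiftingProperty i q) ∧ QuasiIso i ∧ (∀ n, 1 ≤ n → Epi (p.f n)) ∧ i ≫ p = f := by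
  obtain ⟨P, hP, π, hP₀, hπ⟩ : ∃ (P : ℕ → A) (_ : ∀ n, Projective (P n))
      (π : ∀ n, P n ⟶ Y.X n), IsZero (P 0) ∧ ∀ n, 1 ≤ n → Epi (π n) := by
    refine ⟨fun | 0 => (0 : A) | n + 1 => Projective.over (Y.X (n + 1)), ?_,
      fun | 0 => 0 | n + 1 => Projective.π _, isZero_zero _, ?_⟩
    · rintro (_ | n) <;> dsimp <;> infer_instance
    · rintro (_ | n) hn
      · simp at hn
      · dsimp; infer_instance
  refine ⟨X ⊞ disks P, biprod.inl, biprod.desc f (disksDesc π), fun E G q hq => ⟨?_⟩,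
    quasiIso_biprod_inl _ _ (exactAt_disks hP₀), fun n hn => ?_, by simp⟩
  · intro u w sq
    obtain ⟨l, hl⟩ := exists_lift_disks hP₀ q hq (biprod.inr ≫ w)
    exact ⟨⟨{
      l := biprod.desc u l
      fac_left := by simp
      fac_right := by apply biprod.hom_ext' <;> simp [hl, sq.w] }⟩⟩
  · have := hπ n hn
    have h : (biprod.inr ≫ (biprod.inr : disks P ⟶ X ⊞ disks P).f n) ≫
        (biprod.desc f (disksDesc π)).f n = π n := by
      rw [Category.assoc, ← HomologicalComplex.comp_f, biprod.inr_desc]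
      simp
    exact epi_of_epi_fac h

/-- The lifting property of a morphism of complexes with respect to the attachment of
projective cells. -/
structure HasCellLifting {E G : ChainComplex A ℕ} (q : E ⟶ G) : Prop where
  zero ⦃T : A⦄ [Projective T] (g : T ⟶ G.X 0) : ∃ e : T ⟶ E.X 0, e ≫ q.f 0 = g
  succ ⦃T : A⦄ [Projective T] (n : ℕ) (e : T ⟶ E.X n) (g : T ⟶ G.X (n + 1))
    (he : e ≫ E.d n (n - 1) = 0) (h : e ≫ q.f n = g ≫ G.d (n + 1) n) :
    ∃ l : T ⟶ E.X (n + 1), l ≫ E.d (n + 1) n = e ∧ l ≫ q.f (n + 1) = g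

lemma down_next (n : ℕ) : (ComplexShape.down ℕ).next n = n - 1 := by
  cases n <;> simp

lemma exists_cycle_lift_of_epi_homologyMap {E G : ChainComplex A ℕ} (q : E ⟶ G) (n : ℕ)
    [Epi (HomologicalComplex.homologyMap q n)] [Epi (q.f (n + 1))] {T : A} [Projective T]
    (g : T ⟶ G.X n) (hg : g ≫ G.d n (n - 1) = 0) :
    ∃ e : T ⟶ E.X n, e ≫ E.d n (n - 1) = 0 ∧ e ≫ q.f n = g := by
  obtain ⟨T', π, _, e, he, b, hb⟩ := (HomologicalComplex.epi_homologyMap_iff_up_to_refinements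
    q (n + 1) n (n - 1) (by simp) (down_next n)).1 ‹Epi (HomologicalComplex.homologyMap q n)› g hg
  obtain ⟨s, hs⟩ : ∃ s, s ≫ π = 𝟙 T := ⟨_, Projective.factorThru_comp (𝟙 T) π⟩
  refine ⟨s ≫ e + Projective.factorThru (s ≫ b) (q.f (n + 1)) ≫ E.d (n + 1) n, ?_, ?_⟩
  · simp [he]
  · rw [Preadditive.add_comp, Category.assoc, Category.assoc, ← q.comm,
      Projective.factorThru_comp_assoc, Category.assoc, ← Preadditive.comp_add, ← hb,
      reassoc_of% hs]

lemma hasCellLifting_of_quasiIso {E G : ChainComplex A ℕ} (q : E ⟶ G) [QuasiIso q]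
    (hq : ∀ n, 1 ≤ n → Epi (q.f n)) : HasCellLifting q where
  zero T _ g := by
    have := hq 1 le_rfl
    obtain ⟨e, _, he⟩ := exists_cycle_lift_of_epi_homologyMap q 0 g (by simp)
    exact ⟨e, he⟩
  succ T _ n e g he h := by
    have := hq (n + 2) (by simp)
    obtain ⟨T', π, _, l, hl⟩ := (HomologicalComplex.mono_homologyMap_iff_up_to_refinements
      q (n + 1) n (n - 1) (by simp) (down_next n)).1 inferInstance e he g h
    obtain ⟨s, hs⟩ : ∃ s, s ≫ π = 𝟙 T := ⟨_, Projective.factorThru_comp (𝟙 T) π⟩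
    replace hl : (s ≫ l) ≫ E.d (n + 1) n = e := by
      rw [Category.assoc, ← hl, reassoc_of% hs]
    obtain ⟨c, hc, hc'⟩ := exists_cycle_lift_of_epi_homologyMap q (n + 1)
      (g - (s ≫ l) ≫ q.f (n + 1)) (by
        rw [Nat.add_sub_cancel, Preadditive.sub_comp, Category.assoc, q.comm,
          ← Category.assoc (s ≫ l), hl, ← h, sub_self])
    rw [Nat.add_sub_cancel] at hc
    exact ⟨s ≫ l + c, by rw [Preadditive.add_comp, hl, hc, add_zero],
      by rw [Preadditive.add_comp, hc']; abel⟩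

namespace HasCellLifting

variable {E G : ChainComplex A ℕ} {q : E ⟶ G}

lemma exists_cycle_lift (hq : HasCellLifting q) {T : A} [Projective T] (n : ℕ) (g : T ⟶ G.X n)
    (hg : g ≫ G.d n (n - 1) = 0) : ∃ e : T ⟶ E.X n, e ≫ E.d n (n - 1) = 0 ∧ e ≫ q.f n = g := by
  obtain _ | n := n
  · obtain ⟨e, he⟩ := hq.zero g
    exact ⟨e, by simp, he⟩
  · rw [Nat.add_sub_cancel] at hg ⊢
    exact hq.succ n 0 g (by simp) (by simp [hg])

lemma epi_f [EnoughProjectives A] (hq : HasCellLifting q) (n : ℕ) : Epi (q.f n) := by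
  refine epi_of_exists_lift_projective _ fun T _ g => ?_
  obtain _ | n := n
  · exact hq.zero g
  · obtain ⟨e, he, he'⟩ := hq.exists_cycle_lift n (g ≫ G.d (n + 1) n) (by simp)
    obtain ⟨l, -, hl⟩ := hq.succ n e g he he'
    exact ⟨l, hl⟩

lemma quasiIso [EnoughProjectives A] (hq : HasCellLifting q) : QuasiIso q := by
  rw [quasiIso_iff]
  intro n
  rw [quasiIsoAt_iff_isIso_homologyMap]
  have : Mono (HomologicalComplex.homologyMap q n) := by
    rw [HomologicalComplex.mono_homologyMap_iff_up_to_refinements q (n + 1) n (n - 1) (by simp)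
      (down_next n)]
    intro T e he g h
    obtain ⟨l, hl, -⟩ := hq.succ n (Projective.π T ≫ e) (Projective.π T ≫ g)
      (by simp [he]) (by simp [h])
    exact ⟨_, Projective.π T, inferInstance, l, hl.symm⟩
  have : Epi (HomologicalComplex.homologyMap q n) := by
    rw [HomologicalComplex.epi_homologyMap_iff_up_to_refinements q (n + 1) n (n - 1) (by simp)
      (down_next n)]
    intro T g hg
    obtain ⟨e, he, he'⟩ := hq.exists_cycle_lift n (Projective.π T ≫ g) (by simp [hg])
    exact ⟨_, Projective.π T, inferInstance, e, he, 0, by simp [he']⟩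
  exact isIso_of_mono_of_epi _

end HasCellLifting

/-- A morphism of complexes which is in each degree the inclusion of a direct summand with a
projective complement lifts against the morphisms with the cell lifting property. -/
lemma hasLiftingProperty_of_hasCellLifting {X Z : ChainComplex A ℕ} (i : X ⟶ Z) {P : ℕ → A}
    [∀ n, Projective (P n)] (σ : ∀ n, P n ⟶ Z.X n)
    (hσ : ∀ n, IsColimit (BinaryCofan.mk (i.f n) (σ n)))
    {E G : ChainComplex A ℕ} {q : E ⟶ G} (hq : HasCellLifting q) : HasLiftingProperty i q := by
  have glue (n : ℕ) {T : A} (a : X.X n ⟶ T) (b : P n ⟶ T) :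
      ∃ c : Z.X n ⟶ T, i.f n ≫ c = a ∧ σ n ≫ c = b :=
    let ⟨c, hc⟩ := BinaryCofan.IsColimit.desc' (hσ n) a b
    ⟨c, hc⟩
  have hom_ext (n : ℕ) {T : A} {a b : Z.X n ⟶ T} (h₁ : i.f n ≫ a = i.f n ≫ b)
      (h₂ : σ n ≫ a = σ n ≫ b) : a = b := BinaryCofan.IsColimit.hom_ext (hσ n) h₁ h₂
  refine ⟨fun {u w} sq => ?_⟩
  have sqf (n : ℕ) : u.f n ≫ q.f n = i.f n ≫ w.f n := by
    simp only [← HomologicalComplex.comp_f, sq.w]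
  let Partial (n : ℕ) := { h : Z.X n ⟶ E.X n // i.f n ≫ h = u.f n ∧ h ≫ q.f n = w.f n ∧
    Z.d (n + 1) n ≫ h ≫ E.d n (n - 1) = 0 }
  have base : Nonempty (Partial 0) := by
    obtain ⟨e, he⟩ := hq.zero (σ 0 ≫ w.f 0)
    obtain ⟨c, hc₁, hc₂⟩ := glue 0 (u.f 0) e
    exact ⟨c, hc₁, hom_ext 0 (by rw [reassoc_of% hc₁, sqf]) (by rw [reassoc_of% hc₂, he]),
      by simp⟩
  have step (n : ℕ) (h : Partial n) :
      ∃ h' : Partial (n + 1), h'.1 ≫ E.d (n + 1) n = Z.d (n + 1) n ≫ h.1 := by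
    obtain ⟨h, hi, hw, hd⟩ := h
    obtain ⟨l, hl₁, hl₂⟩ := hq.succ n (σ (n + 1) ≫ Z.d (n + 1) n ≫ h) (σ (n + 1) ≫ w.f (n + 1))
      (by simp [hd]) (by simp [hw])
    obtain ⟨c, hc₁, hc₂⟩ := glue (n + 1) (u.f (n + 1)) l
    have hcd : c ≫ E.d (n + 1) n = Z.d (n + 1) n ≫ h :=
      hom_ext (n + 1) (by rw [reassoc_of% hc₁, u.comm, i.comm_assoc, hi])
        (by rw [reassoc_of% hc₂, hl₁])
    refine ⟨⟨c, hc₁, hom_ext (n + 1) (by rw [reassoc_of% hc₁, sqf])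
      (by rw [reassoc_of% hc₂, hl₂]), ?_⟩, hcd⟩
    rw [Nat.add_sub_cancel, hcd, Z.d_comp_d_assoc, zero_comp]
  choose next hnext using step
  let H (n : ℕ) : Partial n := Nat.rec base.some next n
  exact ⟨⟨{
    l :=
      { f := fun n => (H n).1
        comm' := by
          rintro _ n rfl
          exact hnext n (H n) }
    fac_left := by ext n : 1; exact (H n).2.1
    fac_right := by ext n : 1; exact (H n).2.2.1 }⟩⟩

section CellularFactorization

variable {X Y : ChainComplex A ℕ} (f : X ⟶ Y)

/-- The data in degree `n` of a factorization of `f : X ⟶ Y` through a complex obtained from `X`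
by attaching projective cells: the new object in degree `n` is `X.X n ⊞ P`, and `B` is the
subobject through which the differential starting from degree `n + 1` has to factor. -/
structure CellStage (n : ℕ) where
  /-- the cells -/
  P : A
  projective : Projective P
  /-- the map to `Y` -/
  p : X.X n ⊞ P ⟶ Y.X n
  inl_p : biprod.inl ≫ p = f.f n
  /-- the cycles in degree `n` -/
  B : A
  /-- the inclusion of the cycles -/
  ι : B ⟶ X.X n ⊞ P
  mono_ι : Mono ι
  /-- the differential on `X` -/
  a : X.X (n + 1) ⟶ B
  a_ι : a ≫ ι = X.d (n + 1) n ≫ biprod.inl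

namespace CellStage

attribute [instance] projective mono_ι

variable {f} {n : ℕ} (S : CellStage f n)

@[simp]
lemma d_a : X.d (n + 2) (n + 1) ≫ S.a = 0 := by
  rw [← cancel_mono S.ι]
  simp [S.a_ι]

variable [EnoughProjectives A]

/-- The cells to be attached in degree `n + 1`. -/
noncomputable abbrev nextP : A := Projective.over (pullback (S.ι ≫ S.p) (Y.d (n + 1) n))

/-- The differential from degree `n + 1` to the cycles in degree `n`. -/
noncomputable abbrev dNext : X.X (n + 1) ⊞ S.nextP ⟶ S.B :=
  biprod.desc S.a (Projective.π _ ≫ pullback.fst _ _)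

/-- The map to `Y` in degree `n + 1`. -/
noncomputable abbrev nextp : X.X (n + 1) ⊞ S.nextP ⟶ Y.X (n + 1) :=
  biprod.desc (f.f (n + 1)) (Projective.π _ ≫ pullback.snd _ _)

lemma nextp_d : S.nextp ≫ Y.d (n + 1) n = S.dNext ≫ S.ι ≫ S.p := by
  ext
  · simp [reassoc_of% S.a_ι, S.inl_p]
  · simp [← pullback.condition]

/-- The data in degree `n + 1`. -/
noncomputable abbrev next : CellStage f (n + 1) where
  P := S.nextP
  projective := inferInstance
  p := S.nextp
  inl_p := biprod.inl_desc _ _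
  B := kernel S.dNext
  ι := kernel.ι _
  mono_ι := inferInstance
  a := kernel.lift _ (X.d (n + 2) (n + 1) ≫ biprod.inl) (by simp)
  a_ι := by simp

variable (f) in
/-- The data in degree `0`. -/
noncomputable def zero : CellStage f 0 where
  P := Projective.over (Y.X 0)
  projective := inferInstance
  p := biprod.desc (f.f 0) (Projective.π _)
  inl_p := biprod.inl_desc _ _
  B := X.X 0 ⊞ Projective.over (Y.X 0)
  ι := 𝟙 _
  mono_ι := inferInstance
  a := X.d 1 0 ≫ biprod.inl
  a_ι := by simp

variable (f) in
/-- The data in all degrees. -/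
noncomputable abbrev stage : ∀ n, CellStage f n
  | 0 => zero f
  | n + 1 => (stage n).next

end CellStage

open CellStage

variable [EnoughProjectives A]

/-- The complex obtained from `X` by attaching the cells of `CellStage.stage f`. -/
noncomputable abbrev cellComplex : ChainComplex A ℕ :=
  ChainComplex.of (fun n => X.X n ⊞ (stage f n).P) (fun n => (stage f n).dNext ≫ (stage f n).ι)
    (fun n => by
      change (_ ≫ kernel.ι (stage f n).dNext) ≫ _ = 0
      simp)

lemma cellComplex_d (n : ℕ) :
    (cellComplex f).d (n + 1) n = (stage f n).dNext ≫ (stage f n).ι :=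
  ChainComplex.of_d (fun n => X.X n ⊞ (stage f n).P)
    (fun n => (stage f n).dNext ≫ (stage f n).ι) n

/-- The inclusion of `X` in `cellComplex f`. -/
noncomputable abbrev toCellComplex : X ⟶ cellComplex f where
  f _ := biprod.inl
  comm' := by
    rintro _ n rfl
    rw [cellComplex_d]
    exact (biprod.inl_desc_assoc _ _ _).trans (stage f n).a_ι

/-- The projection from `cellComplex f` to `Y`. -/
noncomputable abbrev fromCellComplex : cellComplex f ⟶ Y where
  f n := (stage f n).p
  comm' := by
    rintro _ n rfl
    rw [cellComplex_d, Category.assoc]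
    exact (stage f n).nextp_d

lemma exists_comp_ι_eq (n : ℕ) {T : A} (e : T ⟶ (cellComplex f).X n)
    (he : e ≫ (cellComplex f).d n (n - 1) = 0) : ∃ b, b ≫ (stage f n).ι = e := by
  obtain _ | n := n
  · exact ⟨e, Category.comp_id e⟩
  · rw [Nat.add_sub_cancel, cellComplex_d, ← Category.assoc] at he
    exact ⟨kernel.lift _ e (zero_of_comp_mono _ he), kernel.lift_ι _ _ _⟩

lemma hasCellLifting_fromCellComplex : HasCellLifting (fromCellComplex f) where
  zero T _ g := ⟨Projective.factorThru g (Projective.π _) ≫ biprod.inr, by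
    refine (Category.assoc _ _ _).trans ?_
    exact (congr_arg (_ ≫ ·) (biprod.inr_desc _ _)).trans (Projective.factorThru_comp _ _)⟩
  succ T _ n e g he h := by
    obtain ⟨b, rfl⟩ := exists_comp_ι_eq f n e he
    have hb : b ≫ (stage f n).ι ≫ (stage f n).p = g ≫ Y.d (n + 1) n :=
      (Category.assoc _ _ _).symm.trans h
    let l : T ⟶ (stage f n).nextP :=
      Projective.factorThru (pullback.lift b g hb) (Projective.π _)
    refine ⟨l ≫ biprod.inr, ?_, ?_⟩
    · rw [cellComplex_d]
      simpa [l] using pullback.lift_fst_assoc b g hb _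
    · simpa [stage, l] using pullback.lift_snd b g hb

/-- A factorization into a morphism which lifts against all quasi-isomorphisms that are
epimorphisms in positive degrees, followed by such a morphism. -/
theorem exists_factorization_cellular :
    ∃ (Z : ChainComplex A ℕ) (i : X ⟶ Z) (p : Z ⟶ Y),
      (∀ ⦃E G : ChainComplex A ℕ⦄ (q : E ⟶ G), QuasiIso q → (∀ n, 1 ≤ n → Epi (q.f n)) →
        HasLiftingProperty i q) ∧ (∀ n, 1 ≤ n → Epi (p.f n)) ∧ QuasiIso p ∧ i ≫ p = f :=
  have (n : ℕ) : Projective (stage f n).P := (stage f n).projective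
  ⟨cellComplex f, toCellComplex f, fromCellComplex f,
    fun _ _ q _ hq => hasLiftingProperty_of_hasCellLifting (toCellComplex f)
      (P := fun n => (stage f n).P) (fun n => (biprod.inr : _ ⟶ X.X n ⊞ (stage f n).P))
      (fun n => BinaryBiproduct.isColimit (X.X n) (stage f n).P)
      (hasCellLifting_of_quasiIso q hq),
    fun n _ => (hasCellLifting_fromCellComplex f).epi_f n,
    (hasCellLifting_fromCellComplex f).quasiIso,
    by ext n : 1; exact (stage f n).inl_p⟩

end CellularFactorization

variable (A) in
/-- The morphisms of complexes which are epimorphisms in positive degrees. -/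
def epiInPositiveDegrees : MorphismProperty (ChainComplex A ℕ) :=
  fun _ _ f => ∀ n, 1 ≤ n → Epi (f.f n)

instance : (epiInPositiveDegrees A).IsStableUnderRetracts where
  of_retract h hg n hn :=
    MorphismProperty.of_retract (P := .epimorphisms A)
      (Retract.map h (HomologicalComplex.eval A _ n).mapArrow) (hg n hn)

/-- The model structure on simplicial objects in an abelian category with enough projectives,
obtained from the projective model structure on chain complexes by the Dold-Kan equivalence. -/
theorem isModelCategory_simplicialObject (A : Type u) [Category.{v} A] [Abelian A]
    [EnoughProjectives A] [HasLimits (SimplicialObject A)] [HasColimits (SimplicialObject A)] :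
    IsModelCategory (C := SimplicialObject A)
      (fun _ _ f => ∀ n : ℕ, IsIso (HomologicalComplex.homologyMap
        ((AlgebraicTopology.normalizedMooreComplex A).map f) n))
      (fun _ _ f => ∀ n : ℕ, 1 ≤ n →
        Epi (((AlgebraicTopology.normalizedMooreComplex A).map f).f n))
      (fun _ _ f => ∀ ⦃X Y : SimplicialObject A⦄ (q : X ⟶ Y),
        (∀ n : ℕ, IsIso (HomologicalComplex.homologyMap
          ((AlgebraicTopology.normalizedMooreComplex A).map q) n)) →
        (∀ n : ℕ, 1 ≤ n → Epi (((AlgebraicTopology.normalizedMooreComplex A).map q).f n)) →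
        HasLiftingProperty f q) := by
  have hW : (HomologicalComplex.quasiIso A (ComplexShape.down ℕ)).inverseImage
      Abelian.DoldKan.equivalence.functor =
      fun _ _ f => ∀ n : ℕ, IsIso (HomologicalComplex.homologyMap
        ((AlgebraicTopology.normalizedMooreComplex A).map f) n) := by
    ext X Y f
    simp only [← quasiIsoAt_iff_isIso_homologyMap]
    exact quasiIso_iff _
  have key := IsModelCategory.of_equivalence (C := SimplicialObject A)
    Abelian.DoldKan.equivalence
    (HomologicalComplex.quasiIso A (ComplexShape.down ℕ)) (epiInPositiveDegrees A)
    (fun f => exists_factorization_cellular f) (fun f => exists_factorization_quasiIso_epi f)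
  rw [hW] at key
  exact key

end ChainComplex

/-- for a commutative ring `R`, the category of simplicial `R`-modules
carries a model category structure where `f` is a weak equivalence if it induces an
isomorphism on all homotopy groups (homology of the normalized Moore complex), a fibration
if the induced map of normalized Moore complexes is surjective in degrees `n ≥ 1`, and a
cofibration if it has the left lifting property with respect to all acyclic fibrations. -/
theorem statement13 (R : Type) [CommRing R] :
    IsModelCategory (C := SimplicialObject (ModuleCat R))
      (fun _ _ f => ∀ n : ℕ, IsIso (HomologicalComplex.homologyMap
        ((AlgebraicTopology.normalizedMooreComplex (ModuleCat R)).map f) n))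
      (fun _ _ f => ∀ n : ℕ, 1 ≤ n → Function.Surjective
        (((AlgebraicTopology.normalizedMooreComplex (ModuleCat R)).map f).f n))
      (fun _ _ f => ∀ ⦃X Y : SimplicialObject (ModuleCat R)⦄ (q : X ⟶ Y),
        (∀ n : ℕ, IsIso (HomologicalComplex.homologyMap
          ((AlgebraicTopology.normalizedMooreComplex (ModuleCat R)).map q) n)) →
        (∀ n : ℕ, 1 ≤ n → Function.Surjective
          (((AlgebraicTopology.normalizedMooreComplex (ModuleCat R)).map q).f n)) →
        HasLiftingProperty f q) := by
  simp only [← ModuleCat.epi_iff_surjective]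
  exact ChainComplex.isModelCategory_simplicialObject _
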